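/- Let x be a harmonic bounded operator on F and let I = [i₁, …, i_k] be a nonempty word. Then the sequence (P_ω^n(r_I x)) converges in SOT to r_I x + ∑_{t=1}^{k} ω_{(I^op)_t} • ( r_{I_{k−t}} p_Ω x l_{(I^op)_t} ), where (I^op)_t = [i_k, i_{k−1}, …, i_{k−t+1}] and I_{k−t} = [i₁, …, i_{k−t}]. (This computes the Choi–Effros product r_I ∘ x in the Poisson boundary.) -/

import Mathlib

open Filter Topology

noncomputable section

/-- The full Fock space over a Hilbert space with orthonormal basis indexed by `Θ`,
realized as `ℓ²(List Θ)`. -/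
abbrev Fock (Θ : Type*) : Type _ := lp (fun _ : List Θ => ℂ) 2

/-- The canonical orthonormal basis vector `e_I` of the Fock space, indexed by a word
`I : List Θ`.  The vacuum vector is `Ω = fockBasis []`. -/
noncomputable def fockBasis {Θ : Type*} [DecidableEq Θ] (I : List Θ) : Fock Θ :=
  lp.single 2 I 1

/-- For a word `I = [i₁, …, i_k]`, `wordOp r I = r i₁ ∘L ⋯ ∘L r i_k`, the identity for the
empty word.  Applied to the right (resp. left) creation operators, this gives `r_I`
(resp. `l_I`). -/
noncomputable def wordOp {Θ : Type*} (r : Θ → Fock Θ →L[ℂ] Fock Θ) :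
    List Θ → (Fock Θ →L[ℂ] Fock Θ)
  | [] => 1
  | i :: I => r i ∘L wordOp r I


theorem fockBasis_inner {Θ : Type*} [DecidableEq Θ] (I : List Θ) (v : Fock Θ) :
    (inner ℂ (fockBasis I) v : ℂ) = v I := by
  unfold fockBasis
  rw [lp.inner_single_left]
  simp

theorem fockBasis_apply {Θ : Type*} [DecidableEq Θ] (I J : List Θ) :
    (fockBasis I : Fock Θ) J = if I = J then 1 else 0 := by
  unfold fockBasis
  by_cases h : I = J
  · subst h; simp
  · rw [if_neg h, lp.single_apply_ne _ _ _ (Ne.symm h)]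

theorem fock_ext {Θ : Type*} [DecidableEq Θ] {A B : Fock Θ →L[ℂ] Fock Θ}
    (h : ∀ I, A (fockBasis I) = B (fockBasis I)) : A = B := by
  ext1 v
  have hs := lp.hasSum_single (p := 2) (by simp) v
  have e : ∀ I, lp.single 2 I (v I) = (v I) • (fockBasis I : Fock Θ) := by
    intro I
    unfold fockBasis
    rw [← lp.single_smul]
    simp
  have h1 := A.hasSum hs
  have h2 := B.hasSum hs
  simp only [e, map_smul, h] at h1 h2
  exact h1.unique h2

theorem adj_basis {Θ : Type*} [DecidableEq Θ] (l : Θ → Fock Θ →L[ℂ] Fock Θ)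
    (hl : ∀ (i : Θ) (I : List Θ), l i (fockBasis I) = fockBasis (i :: I)) (i : Θ) (J : List Θ)
    (K : List Θ) :
    (ContinuousLinearMap.adjoint (l i) (fockBasis J) : Fock Θ) K
      = if J = i :: K then 1 else 0 := by
  rw [← fockBasis_inner, ContinuousLinearMap.adjoint_inner_right, hl, fockBasis_inner,
    fockBasis_apply]

theorem adj_nil {Θ : Type*} [DecidableEq Θ] (l : Θ → Fock Θ →L[ℂ] Fock Θ)
    (hl : ∀ (i : Θ) (I : List Θ), l i (fockBasis I) = fockBasis (i :: I)) (i : Θ) :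
    ContinuousLinearMap.adjoint (l i) (fockBasis []) = 0 := by
  ext K
  rw [adj_basis l hl]
  simp

theorem adj_cons {Θ : Type*} [DecidableEq Θ] (l : Θ → Fock Θ →L[ℂ] Fock Θ)
    (hl : ∀ (i : Θ) (I : List Θ), l i (fockBasis I) = fockBasis (i :: I)) (i j : Θ)
    (J : List Θ) :
    ContinuousLinearMap.adjoint (l i) (fockBasis (j :: J)) = if i = j then fockBasis J else 0 := by
  ext K
  rw [adj_basis l hl]
  by_cases h : i = j
  · subst h
    rw [if_pos rfl, fockBasis_apply]
    simp
  · have : ¬ j = i := fun h' => h h'.symm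
    simp [h, this]

theorem l_norm {Θ : Type*} [DecidableEq Θ] (l : Θ → Fock Θ →L[ℂ] Fock Θ)
    (hl : ∀ (i : Θ) (I : List Θ), l i (fockBasis I) = fockBasis (i :: I)) (i : Θ) :
    ‖l i‖ ≤ 1 := by
  have h : ContinuousLinearMap.adjoint (l i) ∘L l i = 1 := by
    apply fock_ext
    intro I
    rw [ContinuousLinearMap.comp_apply, hl, adj_cons l hl]
    simp
  refine ContinuousLinearMap.opNorm_le_bound _ zero_le_one fun v => ?_
  have h2 : (inner ℂ (l i v) (l i v) : ℂ) = inner ℂ v v := by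
    rw [← ContinuousLinearMap.adjoint_inner_right, ← ContinuousLinearMap.comp_apply, h]
    rfl
  rw [inner_self_eq_norm_sq_to_K, inner_self_eq_norm_sq_to_K] at h2
  have h3 : ‖l i v‖ ^ 2 = ‖v‖ ^ 2 := by exact_mod_cast h2
  have := (sq_eq_sq₀ (norm_nonneg _) (norm_nonneg _)).1 h3
  rw [this, one_mul]

theorem P_summable {Θ : Type*} [DecidableEq Θ] (l : Θ → Fock Θ →L[ℂ] Fock Θ)
    (hl : ∀ (i : Θ) (I : List Θ), l i (fockBasis I) = fockBasis (i :: I))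
    (ω : Θ → ℝ) (hω : ∀ i, 0 < ω i) (hs : Summable ω)
    (x : Fock Θ →L[ℂ] Fock Θ) (v : Fock Θ) :
    Summable fun i => (ω i : ℂ) • ((ContinuousLinearMap.adjoint (l i) ∘L x ∘L l i) v) := by
  refine Summable.of_norm_bounded (g := fun i => ω i * (‖x‖ * ‖v‖)) (hs.mul_right _) fun i => ?_
  rw [norm_smul, Complex.norm_real, Real.norm_of_nonneg (hω i).le]
  refine mul_le_mul_of_nonneg_left ?_ (hω i).le
  have hn := l_norm l hl i
  have hn' : ‖ContinuousLinearMap.adjoint (l i)‖ ≤ 1 := by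
    rw [LinearIsometryEquiv.norm_map]; exact hn
  rw [ContinuousLinearMap.comp_apply, ContinuousLinearMap.comp_apply]
  calc _ ≤ 1 * ‖x (l i v)‖ := ContinuousLinearMap.le_of_opNorm_le _ hn' _
    _ ≤ ‖x‖ * ‖l i v‖ := by rw [one_mul]; exact x.le_opNorm _
    _ ≤ ‖x‖ * (1 * ‖v‖) := by
      gcongr
      exact ContinuousLinearMap.le_of_opNorm_le _ hn _
    _ = _ := by rw [one_mul]

theorem wordOp_append {Θ : Type*} (r : Θ → Fock Θ →L[ℂ] Fock Θ) (I J : List Θ) :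
    wordOp r (I ++ J) = wordOp r I ∘L wordOp r J := by
  induction I with
  | nil => rfl
  | cons i I ih => simp only [List.cons_append, wordOp, ih]; rfl

theorem wordOp_r_basis {Θ : Type*} [DecidableEq Θ] (r : Θ → Fock Θ →L[ℂ] Fock Θ)
    (hr : ∀ (i : Θ) (I : List Θ), r i (fockBasis I) = fockBasis (I ++ [i])) (J K : List Θ) :
    wordOp r J (fockBasis K) = fockBasis (K ++ J.reverse) := by
  induction J with
  | nil => simp [wordOp]
  | cons j J ih => simp [wordOp, ih, hr]

theorem adj_wordOp {Θ : Type*} [DecidableEq Θ] (l r : Θ → Fock Θ →L[ℂ] Fock Θ)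
    (hl : ∀ (i : Θ) (I : List Θ), l i (fockBasis I) = fockBasis (i :: I))
    (hr : ∀ (i : Θ) (I : List Θ), r i (fockBasis I) = fockBasis (I ++ [i]))
    (pΩ : Fock Θ →L[ℂ] Fock Θ)
    (hpΩ : ∀ v : Fock Θ,
      pΩ v = (inner ℂ (fockBasis ([] : List Θ)) v : ℂ) • fockBasis ([] : List Θ))
    (i j : Θ) (J : List Θ) :
    ContinuousLinearMap.adjoint (l i) ∘L wordOp r (J ++ [j])
      = wordOp r (J ++ [j]) ∘L ContinuousLinearMap.adjoint (l i)
        + if i = j then wordOp r J ∘L pΩ else 0 := by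
  apply fock_ext
  intro K
  rw [add_apply, ContinuousLinearMap.comp_apply, ContinuousLinearMap.comp_apply,
    wordOp_r_basis r hr]
  cases K with
  | nil =>
    rw [adj_nil l hl, map_zero, zero_add]
    simp only [List.reverse_append, List.reverse_cons, List.reverse_nil, List.nil_append,
      List.singleton_append]
    rw [adj_cons l hl]
    split_ifs with h
    · rw [ContinuousLinearMap.comp_apply, hpΩ, fockBasis_inner, fockBasis_apply]
      simp [wordOp_r_basis r hr]
    · rfl
  | cons k K =>
    rw [List.cons_append, adj_cons l hl, adj_cons l hl]
    have : (if i = j then wordOp r J ∘L pΩ else 0) (fockBasis (k :: K)) = 0 := by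
      split_ifs with h
      · rw [ContinuousLinearMap.comp_apply, hpΩ, fockBasis_inner, fockBasis_apply]
        simp
      · rfl
    rw [this, add_zero]
    split_ifs
    · rw [wordOp_r_basis r hr]
    · simp

/-- For harmonic `x` and a nonempty word `I` of length `k`, the sequence
`(P_ω^n (r_I x))` converges in SOT to
`r_I x + ∑_{t=1}^{k} ω_{(I^op)_t} • (r_{I_{k−t}} p_Ω x l_{(I^op)_t})`,
where `(I^op)_t` is the length-`t` prefix of the reversed word and `I_{k−t}` the
length-`(k−t)` prefix of `I`.  (This computes the Choi–Effros product `r_I ∘ x`.) -/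
theorem statement6 {Θ : Type*} [Countable Θ] [Nonempty Θ] [DecidableEq Θ]
    (l r : Θ → Fock Θ →L[ℂ] Fock Θ)
    (hl : ∀ (i : Θ) (I : List Θ), l i (fockBasis I) = fockBasis (i :: I))
    (hr : ∀ (i : Θ) (I : List Θ), r i (fockBasis I) = fockBasis (I ++ [i]))
    (pΩ : Fock Θ →L[ℂ] Fock Θ)
    (hpΩ : ∀ v : Fock Θ,
      pΩ v = (inner ℂ (fockBasis ([] : List Θ)) v : ℂ) • fockBasis ([] : List Θ))
    (ω : Θ → ℝ) (hω : ∀ i, 0 < ω i) (hω1 : ∑' i, ω i = 1)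
    (P : (Fock Θ →L[ℂ] Fock Θ) → (Fock Θ →L[ℂ] Fock Θ))
    (hP : ∀ (x : Fock Θ →L[ℂ] Fock Θ) (v : Fock Θ),
      P x v = ∑' i, (ω i : ℂ) • ((ContinuousLinearMap.adjoint (l i) ∘L x ∘L l i) v))
    (x : Fock Θ →L[ℂ] Fock Θ) (hx : P x = x) (I : List Θ) (hI : I ≠ []) :
    ∀ v : Fock Θ, Tendsto (fun n : ℕ => (P^[n] (wordOp r I ∘L x)) v) atTop
      (𝓝 ((wordOp r I ∘L x
        + ∑ t ∈ Finset.Icc 1 I.length,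
            (((((I.reverse).take t).map ω).prod : ℝ) : ℂ) •
              (wordOp r (I.take (I.length - t)) ∘L pΩ ∘L x ∘L wordOp l ((I.reverse).take t))) v)) := by
  have hs : Summable ω := by
    by_contra h
    rw [tsum_eq_zero_of_not_summable h] at hω1
    exact zero_ne_one hω1
  have hsum := P_summable l hl ω hω hs
  have Padd : ∀ a b, P (a + b) = P a + P b := by
    intro a b
    ext1 v
    rw [add_apply, hP, hP, hP, ← (hsum a v).tsum_add (hsum b v)]
    refine tsum_congr fun i => ?_
    simp [smul_add]
  have Psmul : ∀ (c : ℂ) a, P (c • a) = c • P a := by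
    intro c a
    ext1 v
    rw [smul_apply, hP, hP, ← (hsum a v).tsum_const_smul c]
    refine tsum_congr fun i => ?_
    simp only [ContinuousLinearMap.comp_apply, smul_apply, map_smul]
    rw [smul_comm]
  have Pzero : P 0 = 0 := by simpa using Psmul 0 0
  let PL : (Fock Θ →L[ℂ] Fock Θ) →+ (Fock Θ →L[ℂ] Fock Θ) :=
    { toFun := P, map_zero' := Pzero, map_add' := Padd }
  have Psum : ∀ (s : Finset ℕ) (f : ℕ → (Fock Θ →L[ℂ] Fock Θ)),
      P (∑ t ∈ s, f t) = ∑ t ∈ s, P (f t) := fun s f => map_sum PL f s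
  have hadjp : ∀ i w, ContinuousLinearMap.adjoint (l i) (pΩ w) = 0 := by
    intro i w
    rw [hpΩ, map_smul, adj_nil l hl, smul_zero]
  have hpp : ∀ w, pΩ (pΩ w) = pΩ w := by
    intro w
    rw [hpΩ (pΩ w), hpΩ w, inner_smul_right, fockBasis_inner [] (fockBasis []), fockBasis_apply]
    simp
  have hcomm : ∀ i j J w, ContinuousLinearMap.adjoint (l i) (wordOp r (J ++ [j]) w)
      = wordOp r (J ++ [j]) (ContinuousLinearMap.adjoint (l i) w)
        + if i = j then wordOp r J (pΩ w) else 0 := by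
    intro i j J w
    have := congrArg (fun T => T w) (adj_wordOp l r hl hr pΩ hpΩ i j J)
    simp only [add_apply, ContinuousLinearMap.comp_apply] at this
    rw [this]
    split_ifs <;> rfl
  have P1 : ∀ y, P (pΩ ∘L y) = 0 := by
    intro y
    ext1 v
    rw [hP]
    simp [hadjp]
  have P2 : ∀ J j y, P (wordOp r (J ++ [j]) ∘L pΩ ∘L y)
      = (ω j : ℂ) • (wordOp r J ∘L pΩ ∘L y ∘L l j) := by
    intro J j y
    ext1 v
    rw [hP, tsum_eq_single j]
    · simp only [ContinuousLinearMap.comp_apply, smul_apply, map_smul, map_add, smul_add, hcomm, hadjp, hpp, map_zero, zero_add, if_true]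
    · intro i hi
      simp [hcomm, hadjp, hi]
  have P3 : ∀ J j, P (wordOp r (J ++ [j]) ∘L x) = wordOp r (J ++ [j]) ∘L x
      + (ω j : ℂ) • (wordOp r J ∘L pΩ ∘L x ∘L l j) := by
    intro J j
    ext1 v
    have hxv : HasSum (fun i => (ω i : ℂ) •
        ((ContinuousLinearMap.adjoint (l i) ∘L x ∘L l i) v)) (x v) := by
      have := (hsum x v).hasSum
      rwa [← hP, hx] at this
    have h1 := (wordOp r (J ++ [j])).hasSum hxv
    have h2 : HasSum (fun i => if i = j then
        (ω j : ℂ) • (wordOp r J ∘L pΩ ∘L x ∘L l j) v else 0)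
        ((ω j : ℂ) • (wordOp r J ∘L pΩ ∘L x ∘L l j) v) := hasSum_ite_eq _ _
    rw [hP]
    refine HasSum.tsum_eq ?_
    rw [add_apply, smul_apply, ContinuousLinearMap.comp_apply]
    convert h1.add h2 using 2 with i
    by_cases hi : i = j
    · subst hi; simp only [ContinuousLinearMap.comp_apply, smul_apply, map_smul, map_add, smul_add, hcomm, if_true]
    · simp only [ContinuousLinearMap.comp_apply, smul_apply, map_smul, map_add, smul_add, hcomm, hi, if_false, smul_zero]
  intro v
  set k := I.length with hk
  let B : ℕ → (Fock Θ →L[ℂ] Fock Θ) := fun t => (((((I.reverse).take t).map ω).prod : ℝ) : ℂ) •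
              (wordOp r (I.take (k - t)) ∘L pΩ ∘L x ∘L wordOp l ((I.reverse).take t))
  have split : ∀ t, t < k → ∃ j, I.take (k - t) = I.take (k - (t + 1)) ++ [j] ∧
      (I.reverse).take (t + 1) = (I.reverse).take t ++ [j] := by
    intro t ht
    refine ⟨I[k - (t + 1)], ?_, ?_⟩
    · have : k - t = (k - (t + 1)) + 1 := by omega
      rw [this, List.take_succ_eq_append_getElem]
    · rw [List.take_succ_eq_append_getElem (by simpa using ht), List.getElem_reverse]
      congr 3
      omega
  have hB0 : P (wordOp r I ∘L x) = wordOp r I ∘L x + B 1 := by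
    have hpos : 0 < k := List.length_pos_of_ne_nil hI
    obtain ⟨j, h1, h2⟩ := split 0 hpos
    simp only [Nat.sub_zero, hk, List.take_length, zero_add, List.take_zero, List.nil_append] at h1 h2
    have h3 : B 1 = (ω j : ℂ) • (wordOp r (I.take (k - 1)) ∘L pΩ ∘L x ∘L l j) := by
      simp only [B, h2]
      simp [wordOp]
      rfl
    rw [h3]
    have := P3 (I.take (k - 1)) j
    rwa [← h1] at this
  have hBs : ∀ t, t < k → P (B t) = B (t + 1) := by
    intro t ht
    obtain ⟨j, h1, h2⟩ := split t ht
    simp only [B]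
    rw [Psmul, h1, h2, P2, wordOp_append, smul_smul]
    congr 1
    simp
  have hBk : P (B k) = 0 := by
    simp only [B]
    rw [Psmul, Nat.sub_self, List.take_zero]
    have := P1 (x ∘L wordOp l ((I.reverse).take k))
    change _ • P (pΩ ∘L x ∘L wordOp l ((I.reverse).take k)) = 0
    rw [this, smul_zero]
  have hn : ∀ n, n ≤ k → P^[n] (wordOp r I ∘L x)
      = wordOp r I ∘L x + ∑ t ∈ Finset.range n, B (t + 1) := by
    intro n
    induction n with
    | zero => simp
    | succ n ih =>
      intro h
      rw [Function.iterate_succ_apply', ih (by omega), Padd, Psum, hB0, Finset.sum_range_succ',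
        Finset.sum_congr rfl fun t ht => hBs (t + 1) (by have := Finset.mem_range.1 ht; omega)]
      abel
  have hfix : P (wordOp r I ∘L x + ∑ t ∈ Finset.range k, B (t + 1))
      = wordOp r I ∘L x + ∑ t ∈ Finset.range k, B (t + 1) := by
    obtain ⟨m, hm⟩ : ∃ m, k = m + 1 :=
      ⟨k - 1, by have : 0 < k := List.length_pos_of_ne_nil hI
                 omega⟩
    rw [Padd, Psum, hB0, hm]
    conv_lhs => rw [Finset.sum_range_succ, ← hm, hBk]
    rw [Finset.sum_range_succ',
        Finset.sum_congr rfl fun t ht => hBs (t + 1) (by have := Finset.mem_range.1 ht; omega)]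
    abel
  have hIcc : ∑ t ∈ Finset.Icc 1 k, B t = ∑ t ∈ Finset.range k, B (t + 1) := by
    rw [Finset.range_eq_Ico, Finset.sum_Ico_add' B 0 k 1]
    rfl
  have hev : ∀ n, k ≤ n → P^[n] (wordOp r I ∘L x)
      = wordOp r I ∘L x + ∑ t ∈ Finset.Icc 1 k, B t := by
    intro n h
    rw [hIcc]
    induction n, h using Nat.le_induction with
    | base => exact hn k le_rfl
    | succ n h ih => rw [Function.iterate_succ_apply', ih, hfix]
  refine tendsto_const_nhds.congr' ?_
  filter_upwards [eventually_ge_atTop k] with n h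
  rw [hev n h]
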